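/- For real numbers a < b, natural numbers n, i with 0 ≤ i ≤ n, and any derivative order p with 0 ≤ p ≤ n, the p-th derivative of the generalized Bernstein basis polynomial satisfies D^p B_{i,n}(x) = (n!/((n-p)! (b-a)^p)) · Σ_{k = max(0, i+p-n)}^{min(i,p)} (-1)^{p+k} · C(p,k) · B_{i-k, n-p}(x) for all real x. -/

import Mathlib

open Finset

/-- Generalized Bernstein basis polynomial of degree `n`, index `i`, over `[a,b]`. -/
noncomputable def bern (a b : ℝ) (n i : ℕ) (x : ℝ) : ℝ :=
  (n.choose i : ℝ) * (x - a) ^ i * (b - x) ^ (n - i) / (b - a) ^ n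

theorem Nat.factorial_mul_choose_mul_descFactorial_mul_descFactorial (k l u v : ℕ) :
    (u + v).factorial * ((k + u + (l + v)).choose (k + u) *
        (k + u).descFactorial k * (l + v).descFactorial l) =
      (k + u + (l + v)).factorial * (u + v).choose u := by
  have hku := Nat.factorial_mul_descFactorial (Nat.le_add_right k u)
  have hlv := Nat.factorial_mul_descFactorial (Nat.le_add_right l v)
  have hn := Nat.choose_mul_factorial_mul_factorial (Nat.le_add_right (k + u) (l + v))
  have huv := Nat.choose_mul_factorial_mul_factorial (Nat.le_add_right u v)
  simp only [Nat.add_sub_cancel_left] at hku hlv hn huv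
  apply Nat.mul_left_cancel (Nat.mul_pos u.factorial_pos v.factorial_pos)
  rw [← hku, ← hlv] at hn
  rw [← hn, ← huv]
  ring

theorem iteratedDeriv_sub_const_pow_mul_const_sub_pow (a b : ℝ) (i j p : ℕ) (x : ℝ) :
    iteratedDeriv p (fun y : ℝ => (y - a) ^ i * (b - y) ^ j) x =
      ∑ k ∈ range (p + 1), (p.choose k : ℝ) * (i.descFactorial k * (x - a) ^ (i - k)) *
        ((-1) ^ (p - k) * (j.descFactorial (p - k) * (b - x) ^ (j - (p - k)))) := by
  rw [iteratedDeriv_fun_mul (by fun_prop) (by fun_prop)]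
  refine sum_congr rfl fun k _ => ?_
  have ha := congrFun (iteratedDeriv_comp_sub_const k (fun y : ℝ => y ^ i) a) x
  have hb := congrFun (iteratedDeriv_comp_const_sub (p - k) (fun y : ℝ => y ^ j) b) x
  simp only [iteratedDeriv_pow, smul_eq_mul] at ha hb
  rw [ha, hb]

theorem bernstein_iteratedDeriv (a b : ℝ) (hab : a < b) (n i p : ℕ)
    (hi : i ≤ n) (hp : p ≤ n) (x : ℝ) :
    iteratedDeriv p (bern a b n i) x =
      (n.factorial : ℝ) / ((n - p).factorial * (b - a) ^ p) *
        ∑ k ∈ Finset.Icc (i + p - n) (min i p),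
          (-1 : ℝ) ^ (p + k) * (p.choose k : ℝ) * bern a b (n - p) (i - k) x := by
  have hfun : bern a b n i = fun y : ℝ =>
      (n.choose i : ℝ) / (b - a) ^ n * ((y - a) ^ i * (b - y) ^ (n - i)) := by
    funext y
    rw [bern]
    ring
  rw [hfun, iteratedDeriv_const_mul_field, iteratedDeriv_sub_const_pow_mul_const_sub_pow,
    mul_sum, mul_sum]
  symm
  refine sum_subset_zero_on_sdiff (fun k hk => ?_) (fun k hk => ?_) (fun k hk => ?_)
  · simp only [mem_Icc, mem_range] at hk ⊢
    omega
  · simp only [mem_sdiff, mem_Icc, mem_range] at hk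
    have h : i < k ∨ n - i < p - k := by omega
    rcases h with h | h <;> simp [Nat.descFactorial_eq_zero_iff_lt.2 h]
  · simp only [mem_Icc] at hk
    obtain ⟨u, rfl⟩ := Nat.exists_eq_add_of_le (show k ≤ i by omega)
    obtain ⟨l, rfl⟩ := Nat.exists_eq_add_of_le (show k ≤ p by omega)
    obtain ⟨v, rfl⟩ : ∃ v, n = k + u + (l + v) := ⟨n - (k + u + l), by omega⟩
    have hcoef := congrArg (Nat.cast : ℕ → ℝ)
      (Nat.factorial_mul_choose_mul_descFactorial_mul_descFactorial k l u v)
    push_cast at hcoef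
    have hsign : (-1 : ℝ) ^ (k + l + k) = (-1) ^ l := by
      rw [show k + l + k = l + 2 * k by ring, pow_add, pow_mul]
      norm_num
    have hba : b - a ≠ 0 := sub_ne_zero.2 hab.ne'
    have hf : ((u + v).factorial : ℝ) ≠ 0 := Nat.cast_ne_zero.2 (Nat.factorial_ne_zero _)
    rw [bern, hsign, show k + u + (l + v) - (k + l) = u + v by omega]
    simp only [Nat.add_sub_cancel_left]
    rw [show k + u + (l + v) = k + l + (u + v) by ring] at hcoef ⊢
    rw [pow_add (b - a) (k + l)]
    field_simp
    linear_combination -((k + l).choose k : ℝ) * (b - x) ^ v * (x - a) ^ u * hcoef
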